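/- Assume U : cl(Λ)×cl(Λ) → [0,∞) is symmetric and continuous. For X = (q₁,…,q_N) ∈ Λ^N let ⟨Δ_X,Δ_X⟩ := N⁻²·( Σ_{1≤i≤N} ½U(q_i,q_i) + I_N(X) ) (the value of the bilinear form ∬½U dρdρ at the empirical measure ρ = N⁻¹Σδ_{q_i}), and set Υ_N(ε) := ln ∫_{Λ^N} ( 1 − ε⁻¹·⟨Δ_X,Δ_X⟩ )₊^{3N/2−1} λ^⊗N(dX). Then there exists a continuous nondecreasing function γ : (ε_g, ∞) → ℝ such that for every ε > ε_g the integral is positive for all sufficiently large N and Υ_N(ε) = N·γ(ε) + o(N) as N → ∞, i.e. Υ_N(ε)/N → γ(ε). -/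

import Mathlib

open MeasureTheory Real Filter Set
open scoped BigOperators ENNReal

noncomputable section

abbrev Euc : Type := EuclideanSpace ℝ (Fin 3)

/-- The `N`-fold product of the normalized Lebesgue measure `λ` on `Λ`. -/
def piNormLeb (Λ : Set Euc) (N : ℕ) : Measure (Fin N → Euc) :=
  ((volume Λ) ^ N)⁻¹ • volume.restrict (Set.univ.pi fun _ => Λ)

/-- Interaction energy `I_N(q) = ∑_{i<j} U(q_i, q_j)`. -/
def interaction (U : Euc → Euc → ℝ) (N : ℕ) (q : Fin N → Euc) : ℝ :=
  ∑ i : Fin N, ∑ j : Fin N, if (i : ℕ) < (j : ℕ) then U (q i) (q j) else 0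

/-- The bilinear pairing `⟨ρ,ρ'⟩ = ∬ ½ U(x,y) ρ(dx) ρ'(dy)`. -/
def pairing (U : Euc → Euc → ℝ) (ρ ρ' : Measure Euc) : ℝ :=
  ∫ x, ∫ y, U x y / 2 ∂ρ' ∂ρ

/-- A Borel probability measure concentrated on `cl(Λ)`. -/
def IsProbOn (Λ : Set Euc) (ρ : Measure Euc) : Prop :=
  IsProbabilityMeasure ρ ∧ ρ ((closure Λ)ᶜ) = 0

/-- `ε_g`, the infimum of `⟨ρ,ρ⟩` over Borel probability measures on `cl(Λ)`. -/
def groundEnergy (U : Euc → Euc → ℝ) (Λ : Set Euc) : ℝ :=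
  sInf { e : ℝ | ∃ ρ : Measure Euc, IsProbOn Λ ρ ∧ e = pairing U ρ ρ }

/-- The value `⟨Δ_X,Δ_X⟩ = N⁻²(∑_i ½U(q_i,q_i) + I_N(X))` of the bilinear form at
the empirical measure of the configuration `X`. -/
def empPair (U : Euc → Euc → ℝ) (N : ℕ) (q : Fin N → Euc) : ℝ :=
  ((N : ℝ) ^ 2)⁻¹ * ((∑ i : Fin N, U (q i) (q i) / 2) + interaction U N q)

/-- The normalized double sum `N⁻² ∑_{i,j} ½ W(q_i, q_j)`. -/
def meanPair {α : Type*} (W : α → α → ℝ) (N : ℕ) (q : Fin N → α) : ℝ :=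
  ((N : ℝ) ^ 2)⁻¹ * ∑ i, ∑ j, W (q i) (q j) / 2

/-- The exponent `3N/2 - 1`. -/
def kinExp (N : ℕ) : ℝ := 3 * (N : ℝ) / 2 - 1

lemma kinExp_pos {N : ℕ} (hN : 1 ≤ N) : 0 < kinExp N := by
  have : (1 : ℝ) ≤ N := by exact_mod_cast hN
  unfold kinExp
  linarith

section Words

variable {ι : Type*}

/-- The number of occurrences of each letter in a word. -/
def letterCount [DecidableEq ι] {N : ℕ} (w : Fin N → ι) (a : ι) : ℕ := ∑ i, if w i = a then 1 else 0

/-- The total weight of the words of length `N` with prescribed letter counts. -/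
def typeWeight [Fintype ι] [DecidableEq ι] (p : ι → ℝ) (N : ℕ) (n : ι → ℕ) : ℝ :=
  ∑ w : Fin N → ι, if letterCount w = n then ∏ i, p (w i) else 0

/-- The weighted sum of `(ε - meanPair V N w)₊ ^ (3N/2 - 1)` over words `w` of length `N`. -/
def wordSum [Fintype ι] (p : ι → ℝ) (V : ι → ι → ℝ) (ε : ℝ) (N : ℕ) : ℝ :=
  ∑ w : Fin N → ι, (∏ i, p (w i)) * (max (ε - meanPair V N w) 0) ^ kinExp N

lemma letterCount_append [DecidableEq ι] {M N : ℕ} (u : Fin M → ι) (v : Fin N → ι) :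
    letterCount (Fin.append u v) = letterCount u + letterCount v := by
  funext a
  simp only [letterCount, Fin.sum_univ_add, Fin.append_left, Fin.append_right, Pi.add_apply]

lemma sum_words_add [Fintype ι] {M N : ℕ} (F : (Fin (M + N) → ι) → ℝ) :
    ∑ w, F w = ∑ u : Fin M → ι, ∑ v : Fin N → ι, F (Fin.append u v) := by
  rw [← (Fin.appendEquiv M N).sum_comp, Fintype.sum_prod_type]
  rfl

lemma wordSum_nonneg [Fintype ι] {p : ι → ℝ} (hp : ∀ a, 0 ≤ p a) (V : ι → ι → ℝ) (ε : ℝ) (N : ℕ) :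
    0 ≤ wordSum p V ε N :=
  Finset.sum_nonneg fun _ _ => mul_nonneg (Finset.prod_nonneg fun _ _ => hp _)
    (Real.rpow_nonneg (le_max_right _ _) _)

variable [Fintype ι] [DecidableEq ι]

lemma sum_letterCount {N : ℕ} (w : Fin N → ι) : ∑ a, letterCount w a = N := by
  simp only [letterCount]
  rw [Finset.sum_comm]
  simp

lemma sum_comp_word {N : ℕ} (w : Fin N → ι) (F : ι → ℝ) :
    ∑ i, F (w i) = ∑ a, (letterCount w a : ℝ) * F a := by
  simp only [letterCount, Nat.cast_sum, Finset.sum_mul]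
  rw [Finset.sum_comm]
  simp

lemma meanPair_eq_letterCount (V : ι → ι → ℝ) {N : ℕ} (w : Fin N → ι) :
    meanPair V N w = ((N : ℝ) ^ 2)⁻¹ *
      ∑ a, ∑ b, (letterCount w a : ℝ) * letterCount w b * (V a b / 2) := by
  unfold meanPair
  congr 1
  rw [sum_comp_word w (fun a => ∑ j, V a (w j) / 2)]
  refine Finset.sum_congr rfl fun a _ => ?_
  rw [sum_comp_word w (fun b => V a b / 2), Finset.mul_sum]
  exact Finset.sum_congr rfl fun b _ => by ring

/-- Repeating a word `k` times and appending `r` letters changes its mean pairing by `O(r)`. -/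
lemma meanPair_le_of_letterCount {V : ι → ι → ℝ} {B : ℝ} (hV : ∀ a b, 0 ≤ V a b ∧ V a b ≤ B)
    {N k r : ℕ} (hN : 1 ≤ N) (hM : 1 ≤ k * N + r) (w : Fin N → ι)
    (u : Fin (k * N) → ι) (v : Fin r → ι) (hu : letterCount u = k • letterCount w) :
    meanPair V (k * N + r) (Fin.append u v) ≤ meanPair V N w + B * r / (k * N + r : ℕ) := by
  rw [meanPair_eq_letterCount, meanPair_eq_letterCount, letterCount_append, hu]
  have hsn : (∑ a, (letterCount w a : ℝ)) = N := by exact_mod_cast sum_letterCount w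
  have hss : (∑ a, (letterCount v a : ℝ)) = r := by exact_mod_cast sum_letterCount v
  set n : ι → ℝ := fun a => (letterCount w a : ℝ) with hn
  set s : ι → ℝ := fun a => (letterCount v a : ℝ) with hs
  have hn0 : ∀ a, 0 ≤ n a := fun a => Nat.cast_nonneg _
  have hs0 : ∀ a, 0 ≤ s a := fun a => Nat.cast_nonneg _
  have key : ∑ a, ∑ b, (((k • letterCount w + letterCount v) a : ℕ) : ℝ) *
        ((k • letterCount w + letterCount v) b : ℕ) * (V a b / 2) ≤
      (k : ℝ) ^ 2 * (∑ a, ∑ b, n a * n b * (V a b / 2)) +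
        (B / 2) * (((k : ℝ) * N + r) ^ 2 - (k * N) ^ 2) := by
    have e : (((k : ℝ) * N + r) ^ 2 - (k * N) ^ 2) =
        ∑ a, ∑ b, ((k * n a + s a) * (k * n b + s b) - k ^ 2 * (n a * n b)) := by
      simp only [Finset.sum_sub_distrib, ← Finset.mul_sum, ← Finset.sum_mul,
        Finset.sum_add_distrib]
      rw [hsn, hss]
      ring
    rw [e, Finset.mul_sum, Finset.mul_sum, ← Finset.sum_add_distrib]
    refine Finset.sum_le_sum fun a _ => ?_
    rw [Finset.mul_sum, Finset.mul_sum, ← Finset.sum_add_distrib]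
    refine Finset.sum_le_sum fun b _ => ?_
    simp only [Pi.add_apply, Pi.smul_apply, smul_eq_mul, Nat.cast_add, Nat.cast_mul]
    have h1 : 0 ≤ (k * n a + s a) * (k * n b + s b) - k ^ 2 * (n a * n b) := by
      have := hn0 a; have := hn0 b; have := hs0 a; have := hs0 b
      have : (k * n a + s a) * (k * n b + s b) - k ^ 2 * (n a * n b) =
        k * n a * s b + s a * (k * n b) + s a * s b := by ring
      rw [this]; positivity
    have h2 := mul_le_mul_of_nonneg_right (hV a b).2 h1
    simp only [hn, hs] at h2 ⊢
    linarith
  have hN' : (0 : ℝ) < N := by exact_mod_cast hN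
  have hM' : (0 : ℝ) < (k : ℝ) * N + r := by exact_mod_cast hM
  have hS : 0 ≤ ∑ a, ∑ b, n a * n b * (V a b / 2) :=
    Finset.sum_nonneg fun a _ => Finset.sum_nonneg fun b _ =>
      mul_nonneg (mul_nonneg (hn0 a) (hn0 b)) (by linarith [(hV a b).1])
  have hB : 0 ≤ B := by
    obtain ⟨a⟩ : Nonempty ι := ⟨w ⟨0, hN⟩⟩
    exact (hV a a).1.trans (hV a a).2
  push_cast
  refine (mul_le_mul_of_nonneg_left key (by positivity)).trans ?_
  set S := ∑ a, ∑ b, n a * n b * (V a b / 2)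
  have hr : (0 : ℝ) ≤ r := Nat.cast_nonneg _
  have hk : (0 : ℝ) ≤ k := Nat.cast_nonneg _
  rw [mul_add]
  refine add_le_add ?_ ?_
  · rw [← mul_assoc]
    refine mul_le_mul_of_nonneg_right ?_ hS
    rw [inv_mul_eq_div, div_le_iff₀ (by positivity), inv_mul_eq_div, le_div_iff₀ (by positivity)]
    nlinarith [mul_nonneg (mul_nonneg hk hN'.le) hr]
  · rw [inv_mul_eq_div, div_le_div_iff₀ (by positivity) hM']
    have : B / 2 * (((k : ℝ) * N + r) ^ 2 - (k * N) ^ 2) ≤ B * r * (k * N + r) := by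
      nlinarith [mul_nonneg hB (sq_nonneg (r : ℝ))]
    calc _ ≤ B * r * (k * N + r) * ((k : ℝ) * N + r) :=
          mul_le_mul_of_nonneg_right this hM'.le
      _ = _ := by ring

lemma typeWeight_nonneg {p : ι → ℝ} (hp : ∀ a, 0 ≤ p a) (N : ℕ) (n : ι → ℕ) :
    0 ≤ typeWeight p N n :=
  Finset.sum_nonneg fun w _ => by
    split_ifs
    exacts [Finset.prod_nonneg fun i _ => hp _, le_rfl]

lemma typeWeight_le_one {p : ι → ℝ} (hp : ∀ a, 0 ≤ p a) (hp1 : ∑ a, p a = 1)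
    (N : ℕ) (n : ι → ℕ) : typeWeight p N n ≤ 1 := by
  calc typeWeight p N n ≤ ∑ w : Fin N → ι, ∏ i, p (w i) :=
        Finset.sum_le_sum fun w _ => by
          split_ifs
          exacts [le_rfl, Finset.prod_nonneg fun i _ => hp _]
    _ = 1 := by rw [← Fintype.sum_pow, hp1, one_pow]

lemma typeWeight_mul_le {p : ι → ℝ} (hp : ∀ a, 0 ≤ p a) (M N : ℕ) (m n : ι → ℕ) :
    typeWeight p M m * typeWeight p N n ≤ typeWeight p (M + N) (m + n) := by
  simp only [typeWeight]
  rw [sum_words_add, Finset.sum_mul_sum]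
  refine Finset.sum_le_sum fun u _ => Finset.sum_le_sum fun v _ => ?_
  have h0 : 0 ≤ (∏ i, p (u i)) * ∏ i, p (v i) :=
    mul_nonneg (Finset.prod_nonneg fun i _ => hp _) (Finset.prod_nonneg fun i _ => hp _)
  rw [Fin.prod_univ_add]
  simp only [Fin.append_left, Fin.append_right, letterCount_append]
  by_cases h1 : letterCount u = m
  · by_cases h2 : letterCount v = n
    · simp [h1, h2]
    · simp only [if_neg h2, mul_zero]
      split_ifs <;> simp [h0]
  · simp only [if_neg h1, zero_mul]
    split_ifs <;> simp [h0]

lemma typeWeight_pow_le {p : ι → ℝ} (hp : ∀ a, 0 ≤ p a) (N : ℕ) (n : ι → ℕ) (k : ℕ) :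
    typeWeight p N n ^ k ≤ typeWeight p (k * N) (k • n) := by
  induction k with
  | zero =>
    rw [Nat.zero_mul]
    simp [typeWeight, letterCount, funext_iff]
  | succ k ih =>
    rw [pow_succ, Nat.succ_mul, succ_nsmul]
    exact (mul_le_mul_of_nonneg_right ih (typeWeight_nonneg hp _ _)).trans
      (typeWeight_mul_le hp _ _ _ _)

lemma typeWeight_pow_mul_le_wordSum {p : ι → ℝ} (hp : ∀ a, 0 ≤ p a) (hp1 : ∑ a, p a = 1)
    {V : ι → ι → ℝ} {B : ℝ} (hV : ∀ a b, 0 ≤ V a b ∧ V a b ≤ B) (ε : ℝ)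
    {N k r : ℕ} (hN : 1 ≤ N) (hM : 1 ≤ k * N + r) (w : Fin N → ι) :
    typeWeight p N (letterCount w) ^ k *
        (max (ε - meanPair V N w - B * r / (k * N + r : ℕ)) 0) ^ kinExp (k * N + r) ≤
      wordSum p V ε (k * N + r) := by
  set G := (max (ε - meanPair V N w - B * r / (k * N + r : ℕ)) 0) ^ kinExp (k * N + r) with hG
  have hG0 : 0 ≤ G := Real.rpow_nonneg (le_max_right _ _) _
  refine (mul_le_mul_of_nonneg_right (typeWeight_pow_le hp N _ k) hG0).trans ?_
  unfold typeWeight wordSum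
  rw [sum_words_add, Finset.sum_mul]
  refine Finset.sum_le_sum fun u _ => ?_
  have hpu : 0 ≤ ∏ i, p (u i) := Finset.prod_nonneg fun i _ => hp _
  have hterm : ∀ v : Fin r → ι, 0 ≤ ∏ i, p (Fin.append u v i) :=
    fun v => Finset.prod_nonneg fun i _ => hp _
  by_cases hu : letterCount u = k • letterCount w
  · rw [if_pos hu]
    have h1 : (∏ i, p (u i)) * G = ∑ v : Fin r → ι, (∏ i, p (Fin.append u v i)) * G := by
      simp only [Fin.prod_univ_add, Fin.append_left, Fin.append_right]
      rw [← Finset.sum_mul, ← Finset.mul_sum, ← Fintype.sum_pow, hp1, one_pow, mul_one]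
    rw [h1]
    refine Finset.sum_le_sum fun v _ => mul_le_mul_of_nonneg_left ?_ (hterm v)
    refine Real.rpow_le_rpow (le_max_right _ _) (max_le_max ?_ le_rfl) (kinExp_pos hM).le
    linarith [meanPair_le_of_letterCount hV hN hM w u v hu]
  · rw [if_neg hu, zero_mul]
    exact Finset.sum_nonneg fun v _ => mul_nonneg (hterm v)
      (Real.rpow_nonneg (le_max_right _ _) _)

/-- There are only polynomially many letter counts, so one of them carries most of the sum. -/
lemma exists_wordSum_le {p : ι → ℝ} (hp : ∀ a, 0 ≤ p a) [Nonempty ι] (V : ι → ι → ℝ) (ε : ℝ)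
    (N : ℕ) : ∃ w : Fin N → ι, wordSum p V ε N ≤
      ((N : ℝ) + 1) ^ Fintype.card ι * (typeWeight p N (letterCount w) *
        (max (ε - meanPair V N w) 0) ^ kinExp N) := by
  set T : Finset (ι → ℕ) := Finset.univ.image (letterCount : (Fin N → ι) → ι → ℕ) with hT
  have hTne : T.Nonempty := Finset.univ_nonempty.image _
  have hcard : (T.card : ℝ) ≤ ((N : ℝ) + 1) ^ Fintype.card ι := by
    have : T ⊆ Fintype.piFinset fun _ => Finset.range (N + 1) := by
      intro n hn
      obtain ⟨w, -, rfl⟩ := Finset.mem_image.1 hn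
      refine Fintype.mem_piFinset.2 fun a => Finset.mem_range.2 (Nat.lt_succ_of_le ?_)
      refine le_of_le_of_eq ?_ (sum_letterCount w)
      exact Finset.single_le_sum (fun _ _ => Nat.zero_le _) (Finset.mem_univ a)
    have := Finset.card_le_card this
    rw [Fintype.card_piFinset] at this
    simp only [Finset.card_range, Finset.prod_const, Finset.card_univ] at this
    exact_mod_cast this
  set g : (Fin N → ι) → ℝ := fun w => (∏ i, p (w i)) * (max (ε - meanPair V N w) 0) ^ kinExp N
  set F : (ι → ℕ) → ℝ := fun n => ∑ w with letterCount w = n, g w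
  have hsum : ∑ n ∈ T, F n = wordSum p V ε N :=
    Finset.sum_fiberwise_of_maps_to (fun w hw => Finset.mem_image_of_mem _ hw) g
  obtain ⟨n, hn, hmax⟩ := T.exists_max_image F hTne
  obtain ⟨w, -, rfl⟩ := Finset.mem_image.1 hn
  have hF : F (letterCount w) =
      typeWeight p N (letterCount w) * (max (ε - meanPair V N w) 0) ^ kinExp N := by
    simp only [F, g, typeWeight, Finset.sum_filter, Finset.sum_mul, ite_mul, zero_mul]
    refine Finset.sum_congr rfl fun v _ => ?_
    split_ifs with h
    · rw [meanPair_eq_letterCount V v, meanPair_eq_letterCount V w, h]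
    · rfl
  refine ⟨w, ?_⟩
  rw [← hsum, ← hF]
  have hF0 : 0 ≤ F (letterCount w) := by
    rw [hF]
    exact mul_nonneg (typeWeight_nonneg hp _ _) (Real.rpow_nonneg (le_max_right _ _) _)
  calc ∑ n ∈ T, F n ≤ T.card • F (letterCount w) := Finset.sum_le_card_nsmul _ _ _ hmax
    _ = T.card * F (letterCount w) := nsmul_eq_mul _ _
    _ ≤ _ := mul_le_mul_of_nonneg_right hcard hF0

/-- The factor `(N+1)^{-K/(3N/2-1)}` lost when only the heaviest of the letter counts over `K`
letters is kept. -/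
def typeLoss (K N : ℕ) : ℝ := ((((N : ℝ) + 1) ^ K) ^ (kinExp N)⁻¹)⁻¹

lemma wordSum_rpow_le {p : ι → ℝ} (hp : ∀ a, 0 ≤ p a) (hp1 : ∑ a, p a = 1)
    {V : ι → ι → ℝ} {B : ℝ} (hV : ∀ a b, 0 ≤ V a b ∧ V a b ≤ B) [Nonempty ι] (ε : ℝ)
    {M N : ℕ} (hN : 1 ≤ N) (hM : 1 ≤ M) :
    typeLoss (Fintype.card ι) N * wordSum p V ε N ^ (kinExp N)⁻¹ - B * N / M ≤
      wordSum p V ε M ^ (kinExp M)⁻¹ := by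
  obtain ⟨w, hw⟩ := exists_wordSum_le hp V ε N
  set P := typeWeight p N (letterCount w)
  have hP0 : 0 ≤ P := typeWeight_nonneg hp _ _
  have hP1 : P ≤ 1 := typeWeight_le_one hp hp1 _ _
  have hB : 0 ≤ B := by
    obtain ⟨a⟩ := ‹Nonempty ι›
    exact (hV a a).1.trans (hV a a).2
  have hqN := kinExp_pos hN
  have hqM := kinExp_pos hM
  set g := max (ε - meanPair V N w) 0
  have hg0 : 0 ≤ g := le_max_right _ _
  have hC : 0 < (((N : ℝ) + 1) ^ Fintype.card ι) ^ (kinExp N)⁻¹ := by positivity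
  have upper : typeLoss (Fintype.card ι) N * wordSum p V ε N ^ (kinExp N)⁻¹ ≤
      P ^ (kinExp N)⁻¹ * g := by
    rw [typeLoss, inv_mul_le_iff₀ hC]
    calc _ ≤ (((N : ℝ) + 1) ^ Fintype.card ι * (P * g ^ kinExp N)) ^ (kinExp N)⁻¹ :=
          Real.rpow_le_rpow (wordSum_nonneg hp _ _ _) hw (by positivity)
      _ = _ := by
          rw [Real.mul_rpow (by positivity) (by positivity), Real.mul_rpow hP0 (by positivity),
            Real.rpow_rpow_inv hg0 hqN.ne']
  set k := M / N
  set r := M % N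
  have hkr : k * N + r = M := by rw [mul_comm]; exact Nat.div_add_mod M N
  have hrN : (r : ℝ) ≤ N := by exact_mod_cast (Nat.mod_lt M hN).le
  have hM' : (0 : ℝ) < M := by exact_mod_cast hM
  have low := typeWeight_pow_mul_le_wordSum hp hp1 hV ε hN (hkr.symm ▸ hM) w (k := k) (r := r)
  rw [hkr] at low
  set g' := max (ε - meanPair V N w - B * r / M) 0
  have hg'0 : 0 ≤ g' := le_max_right _ _
  have hk : (k : ℝ) * (kinExp M)⁻¹ ≤ (kinExp N)⁻¹ := by
    rcases Nat.eq_zero_or_pos k with h | h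
    · rw [h]; simp [hqN.le]
    · rw [← div_eq_mul_inv, ← one_div, div_le_div_iff₀ hqM hqN]
      have h1 : (1 : ℝ) ≤ k := by exact_mod_cast h
      have h2 : (M : ℝ) = k * N + r := by exact_mod_cast hkr.symm
      unfold kinExp
      rw [h2]
      have : (0 : ℝ) ≤ r := Nat.cast_nonneg _
      linarith
  have lower : P ^ (kinExp N)⁻¹ * g' ≤ wordSum p V ε M ^ (kinExp M)⁻¹ := by
    calc _ ≤ P ^ ((k : ℝ) * (kinExp M)⁻¹) * g' := mul_le_mul_of_nonneg_right
          (Real.rpow_le_rpow_of_exponent_ge' hP0 hP1 (by positivity) hk) hg'0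
      _ = (P ^ k * g' ^ kinExp M) ^ (kinExp M)⁻¹ := by
          rw [Real.mul_rpow (by positivity) (by positivity), Real.rpow_rpow_inv hg'0 hqM.ne',
            Real.rpow_mul hP0, Real.rpow_natCast]
      _ ≤ _ := Real.rpow_le_rpow (by positivity) low (by positivity)
  have hPle : P ^ (kinExp N)⁻¹ ≤ 1 := Real.rpow_le_one hP0 hP1 (by positivity)
  have hP' : 0 ≤ P ^ (kinExp N)⁻¹ := by positivity
  have hgg : g - B * N / M ≤ g' := by
    have : B * r / M ≤ B * N / M := by gcongr
    have h3 : 0 ≤ B * N / M := by positivity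
    rcases le_total (ε - meanPair V N w) 0 with h | h
    · simp only [g, max_eq_right h]; linarith
    · simp only [g, max_eq_left h]
      exact le_trans (by linarith) (le_max_left _ _)
  have h3 : 0 ≤ B * N / M := by positivity
  nlinarith [mul_le_mul_of_nonneg_left hgg hP', mul_le_mul_of_nonneg_right hPle h3]

end Words

lemma typeLoss_pos (K N : ℕ) : 0 < typeLoss K N := by
  unfold typeLoss
  positivity

lemma tendsto_typeLoss (K : ℕ) : Tendsto (typeLoss K) atTop (nhds 1) := by
  have h1 : Tendsto (fun N : ℕ => (N : ℝ) + 1) atTop atTop :=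
    tendsto_atTop_add_const_right _ _ tendsto_natCast_atTop_atTop
  have h2 := ((tendsto_rpow_div_mul_add (K : ℝ) (3 / 2) (-(5 / 2)) (by norm_num)).comp h1).inv₀
    one_ne_zero
  rw [inv_one] at h2
  refine h2.congr fun N => ?_
  simp only [Function.comp, typeLoss]
  rw [← Real.rpow_natCast ((N : ℝ) + 1) K, ← Real.rpow_mul (by positivity), div_eq_mul_inv]
  congr 4
  unfold kinExp
  ring

section ExcessNorm

lemma meanPair_nonneg {α : Type*} {W : α → α → ℝ} (hW : ∀ x y, 0 ≤ W x y) (N : ℕ) (q : Fin N → α) :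
    0 ≤ meanPair W N q :=
  mul_nonneg (by positivity) (Finset.sum_nonneg fun _ _ => Finset.sum_nonneg fun _ _ =>
    div_nonneg (hW _ _) zero_le_two)

lemma meanPair_le_add {α : Type*} {W W' : α → α → ℝ} {δ : ℝ} {N : ℕ} (hN : 1 ≤ N) {q q' : Fin N → α}
    (h : ∀ i j, W (q i) (q j) ≤ W' (q' i) (q' j) + 2 * δ) :
    meanPair W N q ≤ meanPair W' N q' + δ := by
  have hN' : (0 : ℝ) < N := by exact_mod_cast hN
  have hd : δ = ((N : ℝ) ^ 2)⁻¹ * ∑ _i : Fin N, ∑ _j : Fin N, δ := by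
    simp
    field_simp
  unfold meanPair
  conv_rhs => rw [hd]
  rw [← mul_add]
  refine mul_le_mul_of_nonneg_left ?_ (by positivity)
  simp only [← Finset.sum_add_distrib]
  exact Finset.sum_le_sum fun i _ => Finset.sum_le_sum fun j _ => by linarith [h i j]

lemma max_sub_meanPair_mem {α : Type*} {W : α → α → ℝ} (hW0 : ∀ x y, 0 ≤ W x y) (ε : ℝ) {N : ℕ}
    (q : Fin N → α) : max (ε - meanPair W N q) 0 ∈ Icc 0 |ε| := by
  refine ⟨le_max_right _ _, max_le ?_ (abs_nonneg _)⟩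
  linarith [meanPair_nonneg hW0 N q, le_abs_self ε]

variable {α : Type*} [MeasurableSpace α]

/-- The integral of `(ε - meanPair W N q)₊ ^ (3N/2 - 1)` over `N` independent points. -/
def excessIntegral (μ : Measure α) (W : α → α → ℝ) (ε : ℝ) (N : ℕ) : ℝ :=
  ∫ q : Fin N → α, (max (ε - meanPair W N q) 0) ^ kinExp N ∂(Measure.pi fun _ => μ)

/-- The `L^{3N/2-1}` norm of `(ε - meanPair W N q)₊` over `N` independent points. -/
def excessNorm (μ : Measure α) (W : α → α → ℝ) (ε : ℝ) (N : ℕ) : ℝ :=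
  excessIntegral μ W ε N ^ (kinExp N)⁻¹

lemma measurable_meanPair {W : α → α → ℝ} (hW : Measurable (Function.uncurry W)) (N : ℕ) :
    Measurable (meanPair W N) := by
  unfold meanPair
  refine Measurable.const_mul (Finset.measurable_sum _ fun i _ =>
    Finset.measurable_sum _ fun j _ => Measurable.div_const ?_ _) _
  have h := hW.comp ((measurable_pi_apply (X := fun _ : Fin N => α) i).prodMk
    (measurable_pi_apply j))
  exact h

lemma measurable_excess {W : α → α → ℝ} (hW : Measurable (Function.uncurry W)) (ε : ℝ) (N : ℕ) :
    Measurable fun q : Fin N → α => max (ε - meanPair W N q) 0 :=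
  (measurable_const.sub (measurable_meanPair hW N)).max measurable_const

variable (μ : Measure α)

lemma excessIntegral_nonneg (W : α → α → ℝ) (ε : ℝ) (N : ℕ) : 0 ≤ excessIntegral μ W ε N :=
  integral_nonneg fun _ => Real.rpow_nonneg (le_max_right _ _) _

lemma excessNorm_nonneg (W : α → α → ℝ) (ε : ℝ) (N : ℕ) : 0 ≤ excessNorm μ W ε N :=
  Real.rpow_nonneg (excessIntegral_nonneg μ W ε N) _

lemma excessNorm_eq_lpNorm {W : α → α → ℝ} (hW : Measurable (Function.uncurry W)) (ε : ℝ)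
    {N : ℕ} (hN : 1 ≤ N) :
    excessNorm μ W ε N = lpNorm (fun q : Fin N → α => max (ε - meanPair W N q) 0)
      (ENNReal.ofReal (kinExp N)) (Measure.pi fun _ => μ) := by
  have hq := kinExp_pos hN
  rw [lpNorm_eq_integral_norm_rpow_toReal (by simpa using hq) ENNReal.ofReal_ne_top
    (measurable_excess hW ε N).aestronglyMeasurable, ENNReal.toReal_ofReal hq.le]
  unfold excessNorm excessIntegral
  congr 1
  refine integral_congr_ae (ae_of_all _ fun q => ?_)
  simp only [Real.norm_of_nonneg (le_max_right (ε - meanPair W N q) 0)]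

variable [IsProbabilityMeasure μ]

lemma integrable_excess {W : α → α → ℝ} (hW : Measurable (Function.uncurry W))
    (hW0 : ∀ x y, 0 ≤ W x y) (ε : ℝ) {N : ℕ} (hN : 1 ≤ N) :
    Integrable (fun q : Fin N → α => (max (ε - meanPair W N q) 0) ^ kinExp N)
      (Measure.pi fun _ => μ) := by
  refine Integrable.of_bound (C := |ε| ^ kinExp N) ?_ (ae_of_all _ fun q => ?_)
  · exact ((measurable_excess hW ε N).pow_const _).aestronglyMeasurable
  · have h := max_sub_meanPair_mem hW0 ε q
    rw [Real.norm_of_nonneg (Real.rpow_nonneg h.1 _)]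
    exact Real.rpow_le_rpow h.1 h.2 (kinExp_pos hN).le

/-- Comparison of two interactions that are close on a set of full measure. -/
lemma excessNorm_le_of_close {W W' : α → α → ℝ} (hW : Measurable (Function.uncurry W))
    (hW0 : ∀ x y, 0 ≤ W x y) (hW' : Measurable (Function.uncurry W'))
    (hW'0 : ∀ x y, 0 ≤ W' x y) {s : Set α} (hs : ∀ᵐ x ∂μ, x ∈ s) {δ : ℝ}
    (hWW' : ∀ x ∈ s, ∀ y ∈ s, W' x y ≤ W x y + 2 * δ) (ε : ℝ) {N : ℕ} (hN : 1 ≤ N) :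
    excessNorm μ W ε N ≤ excessNorm μ W' (ε + δ) N := by
  refine Real.rpow_le_rpow (excessIntegral_nonneg _ _ _ _) ?_ (inv_nonneg.2 (kinExp_pos hN).le)
  refine integral_mono_ae (integrable_excess μ hW hW0 ε hN)
    (integrable_excess μ hW' hW'0 (ε + δ) hN) ?_
  have hq : ∀ᵐ q : Fin N → α ∂(Measure.pi fun _ => μ), ∀ i, q i ∈ s :=
    eventually_all.2 fun i =>
      (Measure.tendsto_eval_ae_ae (μ := fun _ : Fin N => μ) (i := i)).eventually hs
  filter_upwards [hq] with q hq
  refine Real.rpow_le_rpow (le_max_right _ _) (max_le_max ?_ le_rfl) (kinExp_pos hN).le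
  linarith [meanPair_le_add hN fun i j => hWW' (q i) (hq i) (q j) (hq j)]

lemma excessNorm_mono {W : α → α → ℝ} (hW : Measurable (Function.uncurry W))
    (hW0 : ∀ x y, 0 ≤ W x y) {ε ε' : ℝ} (h : ε ≤ ε') {N : ℕ} (hN : 1 ≤ N) :
    excessNorm μ W ε N ≤ excessNorm μ W ε' N := by
  have := excessNorm_le_of_close μ hW hW0 hW hW0 (s := univ) (ae_of_all _ fun _ => mem_univ _)
    (δ := ε' - ε) (fun x _ y _ => by linarith) ε hN
  simpa using this

lemma excessNorm_le_abs {W : α → α → ℝ} (hW : Measurable (Function.uncurry W))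
    (hW0 : ∀ x y, 0 ≤ W x y) (ε : ℝ) {N : ℕ} (hN : 1 ≤ N) :
    excessNorm μ W ε N ≤ |ε| := by
  have hq := kinExp_pos hN
  have : excessIntegral μ W ε N ≤ |ε| ^ kinExp N := by
    calc excessIntegral μ W ε N ≤ ∫ _q : Fin N → α, |ε| ^ kinExp N ∂(Measure.pi fun _ => μ) :=
          integral_mono (integrable_excess μ hW hW0 ε hN) (integrable_const _) fun q =>
            Real.rpow_le_rpow (max_sub_meanPair_mem hW0 ε q).1
              (max_sub_meanPair_mem hW0 ε q).2 hq.le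
      _ = _ := by simp
  calc _ ≤ (|ε| ^ kinExp N) ^ (kinExp N)⁻¹ :=
        Real.rpow_le_rpow (excessIntegral_nonneg _ _ _ _) this (inv_nonneg.2 hq.le)
    _ = _ := Real.rpow_rpow_inv (abs_nonneg _) hq.ne'

lemma excessNorm_add_le {W : α → α → ℝ} (hW : Measurable (Function.uncurry W))
    (hW0 : ∀ x y, 0 ≤ W x y) (ε : ℝ) {δ : ℝ} (hδ : 0 ≤ δ) {N : ℕ} (hN : 2 ≤ N) :
    excessNorm μ W (ε + δ) N ≤ excessNorm μ W ε N + δ := by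
  have hN1 : 1 ≤ N := by omega
  have hq := kinExp_pos hN1
  have hmem : MemLp (fun q : Fin N → α => max (ε - meanPair W N q) 0)
      (ENNReal.ofReal (kinExp N)) (Measure.pi fun _ => μ) :=
    MemLp.of_bound (measurable_excess hW ε N).aestronglyMeasurable |ε| (ae_of_all _ fun q => by
      rw [Real.norm_of_nonneg (max_sub_meanPair_mem hW0 ε q).1]
      exact (max_sub_meanPair_mem hW0 ε q).2)
  have hp : 1 ≤ ENNReal.ofReal (kinExp N) := by
    have : (2 : ℝ) ≤ N := by exact_mod_cast hN
    rw [ENNReal.one_le_ofReal]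
    unfold kinExp
    linarith
  rw [excessNorm_eq_lpNorm μ hW _ hN1, excessNorm_eq_lpNorm μ hW _ hN1]
  calc _ ≤ lpNorm ((fun q : Fin N → α => max (ε - meanPair W N q) 0) + fun _ => δ)
        (ENNReal.ofReal (kinExp N)) (Measure.pi fun _ => μ) := by
        refine lpNorm_mono_real (hmem.add (memLp_const _)) fun q => ?_
        rw [Real.norm_of_nonneg (le_max_right _ _)]
        refine max_le ?_ ?_
        · simp only [Pi.add_apply]
          linarith [le_max_left (ε - meanPair W N q) 0]
        · simp only [Pi.add_apply]
          linarith [le_max_right (ε - meanPair W N q) 0]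
    _ ≤ _ := lpNorm_add_le hmem hp
    _ = _ := by
        rw [lpNorm_const (by simpa using hq) (IsProbabilityMeasure.ne_zero _)]
        simp [abs_of_nonneg hδ]

lemma excessNorm_div_mono {W : α → α → ℝ} (hW : Measurable (Function.uncurry W))
    (hW0 : ∀ x y, 0 ≤ W x y) {ε ε' : ℝ} (hε : 0 < ε) (h : ε ≤ ε') {N : ℕ} (hN : 1 ≤ N) :
    excessNorm μ W ε N / ε ≤ excessNorm μ W ε' N / ε' := by
  have hq := kinExp_pos hN
  have hε' : 0 < ε' := hε.trans_le h
  have key : (ε' / ε) ^ kinExp N * excessIntegral μ W ε N ≤ excessIntegral μ W ε' N := by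
    unfold excessIntegral
    rw [← integral_const_mul]
    refine integral_mono ((integrable_excess μ hW hW0 ε hN).const_mul _)
      (integrable_excess μ hW hW0 ε' hN) fun q => ?_
    have h0 := meanPair_nonneg hW0 N q
    simp only
    rw [← Real.mul_rpow (by positivity) (le_max_right _ _)]
    refine Real.rpow_le_rpow (by positivity) ?_ hq.le
    rw [div_mul_eq_mul_div, div_le_iff₀ hε]
    rcases le_total (ε - meanPair W N q) 0 with h1 | h1
    · rw [max_eq_right h1, mul_zero]
      positivity
    · rw [max_eq_left h1]
      refine le_trans ?_ (mul_le_mul_of_nonneg_right (le_max_left _ _) hε.le)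
      nlinarith
  have h2 := Real.rpow_le_rpow (mul_nonneg (by positivity) (excessIntegral_nonneg μ W ε N)) key
    (inv_nonneg.2 hq.le)
  rw [Real.mul_rpow (by positivity) (excessIntegral_nonneg μ W ε N),
    Real.rpow_rpow_inv (by positivity) hq.ne'] at h2
  rw [div_le_div_iff₀ hε hε']
  have h3 := mul_le_mul_of_nonneg_right h2 hε.le
  unfold excessNorm
  calc _ = ε' / ε * excessIntegral μ W ε N ^ (kinExp N)⁻¹ * ε := by field_simp
    _ ≤ _ := h3

/-- For an interaction that factors through finitely many letters, the integral over
configurations is a sum over words. -/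
lemma excessIntegral_factor {ι : Type*} [Fintype ι] [MeasurableSpace ι]
    [MeasurableSingletonClass ι] {c : α → ι} (hc : Measurable c) (V : ι → ι → ℝ) (ε : ℝ) (N : ℕ) :
    excessIntegral μ (fun x y => V (c x) (c y)) ε N =
      wordSum (fun a => (μ.map c).real {a}) V ε N := by
  have : IsProbabilityMeasure (μ.map c) := Measure.isProbabilityMeasure_map hc.aemeasurable
  have hmp := measurePreserving_pi (fun _ : Fin N => μ) (fun _ => μ.map c)
    (f := fun _ => c) fun _ => ⟨hc, rfl⟩
  have e : excessIntegral μ (fun x y => V (c x) (c y)) ε N =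
      ∫ w : Fin N → ι, (max (ε - meanPair V N w) 0) ^ kinExp N
        ∂(Measure.pi fun _ => μ.map c) := by
    rw [← hmp.map_eq, integral_map hmp.measurable.aemeasurable
      (measurable_of_countable _).aestronglyMeasurable]
    rfl
  rw [e, integral_fintype (Integrable.of_finite)]
  refine Finset.sum_congr rfl fun w _ => ?_
  rw [smul_eq_mul, measureReal_def, Measure.pi_singleton, ENNReal.toReal_prod]
  rfl

/-- An interaction that is uniformly approximated by one depending on finitely many letters
satisfies an approximate supermultiplicativity. -/
lemma excessNorm_superadditive {W : α → α → ℝ} (hW : Measurable (Function.uncurry W))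
    (hW0 : ∀ x y, 0 ≤ W x y) {s : Set α} (hs : ∀ᵐ x ∂μ, x ∈ s)
    {ι : Type*} [Fintype ι] [Nonempty ι] [MeasurableSpace ι] [MeasurableSingletonClass ι]
    {c : α → ι} (hc : Measurable c) {V : ι → ι → ℝ} {B : ℝ} (hV : ∀ a b, 0 ≤ V a b ∧ V a b ≤ B)
    {δ : ℝ} (hWV : ∀ x ∈ s, ∀ y ∈ s, |W x y - V (c x) (c y)| ≤ 2 * δ) (ε : ℝ)
    {N M : ℕ} (hN : 1 ≤ N) (hM : 1 ≤ M) :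
    typeLoss (Fintype.card ι) N * excessNorm μ W (ε - 2 * δ) N - B * N / M ≤
      excessNorm μ W ε M := by
  classical
  have : IsProbabilityMeasure (μ.map c) := Measure.isProbabilityMeasure_map hc.aemeasurable
  have hVm : Measurable (Function.uncurry fun x y => V (c x) (c y)) :=
    (measurable_of_countable (Function.uncurry V)).comp
      ((hc.comp measurable_fst).prodMk (hc.comp measurable_snd))
  have h1 := excessNorm_le_of_close μ hW hW0 hVm (fun x y => (hV _ _).1) hs (δ := δ)
    (fun x hx y hy => by linarith [(abs_le.1 (hWV x hx y hy)).1]) (ε - 2 * δ) hN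
  have h2 := excessNorm_le_of_close μ hVm (fun x y => (hV _ _).1) hW hW0 hs (δ := δ)
    (fun x hx y hy => by linarith [(abs_le.1 (hWV x hx y hy)).2]) (ε - δ) hM
  have h3 := wordSum_rpow_le (p := fun a => (μ.map c).real {a}) (fun a => measureReal_nonneg)
    (by rw [sum_measureReal_singleton]; simp) hV (ε - δ) hN hM
  rw [show ε - 2 * δ + δ = ε - δ by ring] at h1
  rw [sub_add_cancel] at h2
  unfold excessNorm at h1 h2 ⊢
  rw [excessIntegral_factor μ hc] at h1 h2
  linarith [mul_le_mul_of_nonneg_left h1 (typeLoss_pos (Fintype.card ι) N).le]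

end ExcessNorm

/-- A bounded nonnegative sequence satisfying an approximate superadditivity converges. -/
lemma exists_tendsto_of_superadditive {h : ℕ → ℝ} {C : ℝ} (h0 : ∀ N, 1 ≤ N → 0 ≤ h N)
    (hC : ∀ N, 1 ≤ N → h N ≤ C) {B : ℝ}
    (hsup : ∀ δ > 0, ∃ c : ℕ → ℝ, Tendsto c atTop (nhds 1) ∧
      ∀ᶠ N in atTop, ∀ᶠ M : ℕ in atTop, c N * h N - δ - B * N / M ≤ h M) :
    ∃ l, Tendsto h atTop (nhds l) := by
  have hev0 : ∀ᶠ N in atTop, 0 ≤ h N := (eventually_ge_atTop 1).mono h0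
  have hevC : ∀ᶠ N in atTop, h N ≤ C := (eventually_ge_atTop 1).mono hC
  have hbA : IsBoundedUnder (· ≤ ·) atTop h := isBoundedUnder_of_eventually_le hevC
  have hbB : IsBoundedUnder (· ≥ ·) atTop h := isBoundedUnder_of_eventually_ge hev0
  refine ⟨liminf h atTop, tendsto_of_le_liminf_of_limsup_le le_rfl ?_ hbA hbB⟩
  refine le_of_forall_pos_le_add fun η hη => ?_
  obtain ⟨c, hc, hcN⟩ := hsup (η / 2) (by positivity)
  have hlow : ∀ᶠ N in atTop, c N * h N - η / 2 ≤ liminf h atTop := by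
    filter_upwards [hcN] with N hN
    have ht : Tendsto (fun M : ℕ => c N * h N - η / 2 - B * N / M) atTop
        (nhds (c N * h N - η / 2)) := by
      simpa using tendsto_const_nhds.sub (tendsto_const_div_atTop_nhds_zero_nat (B * N))
    rw [← ht.liminf_eq]
    exact liminf_le_liminf hN ht.isBoundedUnder_ge hbA.isCoboundedUnder_ge
  have hC0 : Tendsto (fun N => |c N - 1| * C) atTop (nhds 0) := by
    simpa using ((hc.sub_const 1).abs).mul_const C
  refine limsup_le_of_le hbB.isCoboundedUnder_le ?_
  filter_upwards [hlow, hev0, hevC, hC0.eventually (gt_mem_nhds (half_pos hη))] with N h1 h2 h3 h4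
  have : (1 - c N) * h N ≤ |c N - 1| * C := by
    calc _ ≤ |c N - 1| * h N :=
          mul_le_mul_of_nonneg_right (by rw [abs_sub_comm]; exact le_abs_self _) h2
      _ ≤ _ := mul_le_mul_of_nonneg_left h3 (abs_nonneg _)
  linarith

/-- A continuous interaction is uniformly approximated on bounded sets by finitely many letters,
so its excess norms are approximately supermultiplicative. -/
lemma excessNorm_superadditive_of_continuous (μ : Measure Euc) [IsProbabilityMeasure μ]
    {Λ : Set Euc} (hΛ : Bornology.IsBounded Λ) (hs : ∀ᵐ x ∂μ, x ∈ Λ)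
    {W : Euc → Euc → ℝ} (hW : Continuous (Function.uncurry W)) {B : ℝ}
    (hWB : ∀ x y, 0 ≤ W x y ∧ W x y ≤ B) {δ : ℝ} (hδ : 0 < δ) :
    ∃ K : ℕ, ∀ (ε : ℝ) (N M : ℕ), 1 ≤ N → 1 ≤ M →
      typeLoss K N * excessNorm μ W (ε - 2 * δ) N - B * N / M ≤ excessNorm μ W ε M := by
  have hK : IsCompact (closure Λ) := hΛ.isCompact_closure
  obtain ⟨r, hr, hclose⟩ := Metric.mem_uniformity_dist.1
    ((hK.prod hK).uniformContinuousAt_of_continuousAt (Function.uncurry W)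
      (fun a _ => hW.continuousAt) (Metric.dist_mem_uniformity (show 0 < 2 * δ by positivity)))
  set e := TopologicalSpace.denseSeq Euc
  obtain ⟨t, ht⟩ := hK.elim_finite_subcover (fun k : ℕ => Metric.ball (e k) r)
    (fun _ => Metric.isOpen_ball) fun x _ => by
      obtain ⟨_, ⟨k, rfl⟩, hk⟩ := Metric.dense_iff.1 (TopologicalSpace.denseRange_denseSeq Euc)
        x r hr |>.imp fun y hy => And.symm hy
      exact mem_iUnion.2 ⟨k, Metric.mem_ball_comm.1 hk⟩
  set s := SimpleFunc.nearestPt e (t.sup id)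
  have hsr : ∀ x ∈ Λ, dist x (s x) < r := by
    intro x hx
    obtain ⟨k, hk, hxk⟩ := mem_iUnion₂.1 (ht (subset_closure hx))
    have h1 := SimpleFunc.edist_nearestPt_le e x (Finset.le_sup (f := id) hk)
    rw [edist_dist, edist_dist, ENNReal.ofReal_le_ofReal_iff dist_nonneg] at h1
    rw [dist_comm]
    exact h1.trans_lt (Metric.mem_ball'.1 hxk)
  let c : Euc → s.range := fun x => ⟨s x, s.mem_range_self x⟩
  have hc : Measurable c := s.measurable.subtype_mk
  have : Nonempty s.range := ⟨c 0⟩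
  refine ⟨Fintype.card s.range, fun ε N M hN hM => ?_⟩
  refine excessNorm_superadditive μ hW.measurable (fun x y => (hWB x y).1) hs hc
    (V := fun a b => W a b) (fun a b => hWB a b) (fun x hx y hy => ?_) ε hN hM
  have := @hclose (x, y) (s x, s y) (by
    rw [Prod.dist_eq]
    exact max_lt (hsr x hx) (hsr y hy)) ⟨subset_closure hx, subset_closure hy⟩
  exact (le_of_lt this : dist (W x y) (W (s x) (s y)) ≤ 2 * δ)

/-- The mean of `meanPair` over independent points of law `ρ` is close to the pairing of `ρ`. -/
lemma integral_meanPair_le (ρ : Measure Euc) [IsProbabilityMeasure ρ]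
    {W : Euc → Euc → ℝ} (hW : Measurable (Function.uncurry W)) {B : ℝ}
    (hWB : ∀ x y, 0 ≤ W x y ∧ W x y ≤ B) {N : ℕ} (hN : 1 ≤ N) :
    ∫ q : Fin N → Euc, meanPair W N q ∂(Measure.pi fun _ => ρ) ≤
      pairing W ρ ρ + B / 2 / N := by
  have hm : ∀ i j : Fin N, Measurable fun q : Fin N → Euc => W (q i) (q j) / 2 := fun i j => by
    have h := hW.comp ((measurable_pi_apply (X := fun _ : Fin N => Euc) i).prodMk
      (measurable_pi_apply j))
    exact h.div_const 2
  have hint : ∀ i j : Fin N, Integrable (fun q : Fin N → Euc => W (q i) (q j) / 2)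
      (Measure.pi fun _ => ρ) := fun i j =>
    Integrable.of_bound (hm i j).aestronglyMeasurable (B / 2) (ae_of_all _ fun q => by
      rw [Real.norm_of_nonneg (by linarith [(hWB (q i) (q j)).1])]
      linarith [(hWB (q i) (q j)).2])
  have hint2 : Integrable (fun z : Euc × Euc => W z.1 z.2 / 2) (ρ.prod ρ) :=
    Integrable.of_bound (hW.div_const 2).aestronglyMeasurable (B / 2) (ae_of_all _ fun z => by
      rw [Real.norm_of_nonneg (by linarith [(hWB z.1 z.2).1])]
      linarith [(hWB z.1 z.2).2])
  have hpair : 0 ≤ pairing W ρ ρ := integral_nonneg fun x => integral_nonneg fun y => by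
    have := (hWB x y).1
    positivity
  have hij : ∀ i j : Fin N, ∫ q : Fin N → Euc, W (q i) (q j) / 2 ∂(Measure.pi fun _ => ρ) ≤
      pairing W ρ ρ + if i = j then B / 2 else 0 := by
    intro i j
    by_cases h : i = j
    · rw [if_pos h]
      have : ∫ q : Fin N → Euc, W (q i) (q j) / 2 ∂(Measure.pi fun _ => ρ) ≤
          ∫ _q : Fin N → Euc, B / 2 ∂(Measure.pi fun _ => ρ) :=
        integral_mono (hint i j) (integrable_const _) fun q => by
          simp only
          linarith [(hWB (q i) (q j)).2]
      rw [integral_const] at this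
      simp at this
      linarith
    · rw [if_neg h, add_zero]
      have hind := (ProbabilityTheory.iIndepFun_pi (μ := fun _ : Fin N => ρ)
        (X := fun _ => id) fun _ => aemeasurable_id).indepFun h
      have hmap := (ProbabilityTheory.indepFun_iff_map_prod_eq_prod_map_map
        (measurable_pi_apply i).aemeasurable (measurable_pi_apply j).aemeasurable).1 hind
      rw [(measurePreserving_eval (fun _ : Fin N => ρ) i).map_eq,
        (measurePreserving_eval (fun _ : Fin N => ρ) j).map_eq] at hmap
      have h2 := integral_map (μ := Measure.pi fun _ : Fin N => ρ)
        (φ := fun q : Fin N → Euc => (q i, q j))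
        ((measurable_pi_apply i).prodMk (measurable_pi_apply j)).aemeasurable
        (f := fun z : Euc × Euc => W z.1 z.2 / 2) (hW.div_const 2).aestronglyMeasurable
      rw [← h2, hmap, integral_prod _ hint2]
      rfl
  have hN' : (0 : ℝ) < N := by exact_mod_cast hN
  unfold meanPair
  rw [integral_const_mul, integral_finsetSum _ fun i _ => integrable_finsetSum _ fun j _ =>
    hint i j, inv_mul_le_iff₀ (by positivity)]
  calc _ ≤ ∑ i : Fin N, ∑ j : Fin N, (pairing W ρ ρ + if i = j then B / 2 else 0) :=
        Finset.sum_le_sum fun i _ => by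
          rw [integral_finsetSum _ fun j _ => hint i j]
          exact Finset.sum_le_sum fun j _ => hij i j
    _ = _ := by
        simp only [Finset.sum_add_distrib, Finset.sum_ite_eq, Finset.mem_univ, if_true,
          Finset.sum_const, Finset.card_univ, Fintype.card_fin, nsmul_eq_mul]
        field_simp

lemma exists_meanPair_lt (ρ : Measure Euc) [IsProbabilityMeasure ρ]
    {W : Euc → Euc → ℝ} (hW : Measurable (Function.uncurry W)) {B : ℝ}
    (hWB : ∀ x y, 0 ≤ W x y ∧ W x y ≤ B) {s : Set Euc} (hs : ∀ᵐ x ∂ρ, x ∈ s) {ε : ℝ}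
    (hε : pairing W ρ ρ < ε) :
    ∃ N : ℕ, 1 ≤ N ∧ ∃ q : Fin N → Euc, (∀ i, q i ∈ s) ∧ meanPair W N q < ε := by
  have ht : Tendsto (fun N : ℕ => pairing W ρ ρ + B / 2 / N) atTop (nhds (pairing W ρ ρ)) := by
    simpa using tendsto_const_nhds.add (tendsto_const_div_atTop_nhds_zero_nat (B / 2))
  obtain ⟨N, hNε, hN⟩ := ((ht.eventually (gt_mem_nhds hε)).and (eventually_ge_atTop 1)).exists
  refine ⟨N, hN, ?_⟩
  by_contra! hcon
  have hq : ∀ᵐ q : Fin N → Euc ∂(Measure.pi fun _ => ρ), ∀ i, q i ∈ s :=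
    eventually_all.2 fun i =>
      (Measure.tendsto_eval_ae_ae (μ := fun _ : Fin N => ρ) (i := i)).eventually hs
  have hint : Integrable (meanPair W N) (Measure.pi fun _ : Fin N => ρ) :=
    Integrable.of_bound (measurable_meanPair hW N).aestronglyMeasurable (0 + B / 2)
      (ae_of_all _ fun q => by
        rw [Real.norm_of_nonneg (meanPair_nonneg (fun x y => (hWB x y).1) N q)]
        refine (meanPair_le_add (W' := fun _ _ => 0) (q' := q) (δ := B / 2) hN fun i j => ?_).trans
          (by simp [meanPair])
        linarith [(hWB (q i) (q j)).2])
  have := integral_mono_ae (integrable_const ε) hint (hq.mono fun q h => hcon q h)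
  rw [integral_const] at this
  simp at this
  linarith [integral_meanPair_le ρ hW hWB hN]

lemma empPair_eq_meanPair {U W : Euc → Euc → ℝ} {N : ℕ} {q : Fin N → Euc}
    (hsymm : ∀ i j, U (q i) (q j) = U (q j) (q i))
    (hUW : ∀ i j, W (q i) (q j) = U (q i) (q j)) : empPair U N q = meanPair W N q := by
  unfold empPair meanPair interaction
  congr 1
  simp only [hUW]
  have h1 : ∀ i j : Fin N, U (q i) (q j) / 2 =
      (if i = j then U (q i) (q j) / 2 else 0) +
      ((if (i : ℕ) < j then U (q i) (q j) / 2 else 0) +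
        if (j : ℕ) < i then U (q i) (q j) / 2 else 0) := by
    intro i j
    rcases lt_trichotomy i j with h | h | h
    · simp [h, h.ne, h.not_gt]
    · simp [h]
    · simp [h, h.ne', h.not_gt]
  have h2 : ∑ i : Fin N, ∑ j : Fin N, (if (j : ℕ) < i then U (q i) (q j) / 2 else 0) =
      ∑ i : Fin N, ∑ j : Fin N, (if (i : ℕ) < j then U (q i) (q j) / 2 else 0) := by
    rw [Finset.sum_comm]
    simp only [hsymm]
  conv_rhs =>
    enter [2, i, 2, j]
    rw [h1]
  simp only [Finset.sum_add_distrib]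
  rw [h2, ← Finset.sum_add_distrib (f := fun i : Fin N => ∑ j : Fin N,
    if (i : ℕ) < j then U (q i) (q j) / 2 else 0)]
  congr 1
  · simp
  · refine Finset.sum_congr rfl fun i _ => ?_
    rw [← Finset.sum_add_distrib]
    refine Finset.sum_congr rfl fun j _ => ?_
    split_ifs <;> ring

/-- The normalized Lebesgue measure on a set. -/
def normLeb (Λ : Set Euc) : Measure Euc := (volume Λ)⁻¹ • volume.restrict Λ

lemma isProbabilityMeasure_normLeb {Λ : Set Euc} (h0 : volume Λ ≠ 0) (h1 : volume Λ ≠ ∞) :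
    IsProbabilityMeasure (normLeb Λ) :=
  ⟨by simp [normLeb, ENNReal.inv_mul_cancel h0 h1]⟩

lemma pi_normLeb {Λ : Set Euc} (h0 : volume Λ ≠ 0) (h1 : volume Λ ≠ ∞) (N : ℕ) :
    Measure.pi (fun _ : Fin N => normLeb Λ) = piNormLeb Λ N := by
  have := isProbabilityMeasure_normLeb h0 h1
  refine Measure.pi_eq fun s hs => ?_
  have h2 : (volume : Measure (Fin N → Euc)).restrict (univ.pi fun _ => Λ) =
      Measure.pi fun _ => (volume : Measure Euc).restrict Λ :=
    Measure.restrict_pi_pi (fun _ : Fin N => (volume : Measure Euc)) fun _ => Λ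
  have : IsFiniteMeasure ((volume : Measure Euc).restrict Λ) := ⟨by simpa using h1.lt_top⟩
  rw [piNormLeb, h2, Measure.smul_apply, Measure.pi_pi]
  simp [normLeb, Finset.prod_mul_distrib, ENNReal.inv_pow]

/-- Above the ground energy some excess integral is positive. -/
lemma exists_excessIntegral_pos {Λ : Set Euc} (hopen : IsOpen Λ) (h0 : volume Λ ≠ 0)
    (h1 : volume Λ ≠ ∞) {W : Euc → Euc → ℝ} (hW : Continuous (Function.uncurry W)) {B : ℝ}
    (hWB : ∀ x y, 0 ≤ W x y ∧ W x y ≤ B) {ε : ℝ} (hε : groundEnergy W Λ < ε) :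
    ∃ N : ℕ, 1 ≤ N ∧ 0 < excessIntegral (normLeb Λ) W ε N := by
  have hprob := isProbabilityMeasure_normLeb h0 h1
  have hne : Λ.Nonempty := nonempty_of_measure_ne_zero h0
  obtain ⟨x₀, hx₀⟩ := hne
  have hset : { e : ℝ | ∃ ρ : Measure Euc, IsProbOn Λ ρ ∧ e = pairing W ρ ρ }.Nonempty :=
    ⟨_, Measure.dirac x₀, ⟨inferInstance, by simp [subset_closure hx₀]⟩, rfl⟩
  obtain ⟨_, ⟨ρ, ⟨hρ, hρs⟩, rfl⟩, hlt⟩ := exists_lt_of_csInf_lt hset hε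
  obtain ⟨N, hN, y, hy, hyε⟩ := exists_meanPair_lt ρ hW.measurable hWB
    (s := closure Λ) (mem_ae_iff.2 hρs) hlt
  refine ⟨N, hN, ?_⟩
  have hcont : Continuous (meanPair W N) := by
    unfold meanPair
    refine continuous_const.mul (continuous_finsetSum _ fun i _ =>
      continuous_finsetSum _ fun j _ => Continuous.div_const ?_ _)
    have h : Continuous fun q : Fin N → Euc => (q i, q j) := by fun_prop
    exact hW.comp h
  set O : Set (Fin N → Euc) := {q | meanPair W N q < ε}
  have hO : IsOpen O := isOpen_lt hcont continuous_const
  set P : Set (Fin N → Euc) := univ.pi fun _ => Λ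
  have hP : IsOpen P := isOpen_set_pi finite_univ fun _ _ => hopen
  have hyP : y ∈ closure P := by
    rw [closure_pi_set]
    exact fun i _ => hy i
  have hOP : (O ∩ P).Nonempty := mem_closure_iff.1 hyP O hO hyε
  have hpos : 0 < Measure.pi (fun _ : Fin N => normLeb Λ) O := by
    rw [pi_normLeb h0 h1, piNormLeb, Measure.smul_apply, Measure.restrict_apply hO.measurableSet,
      smul_eq_mul]
    exact ENNReal.mul_pos (ENNReal.inv_ne_zero.2 (ENNReal.pow_ne_top h1))
      ((hO.inter hP).measure_pos volume hOP).ne'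
  rw [excessIntegral, integral_pos_iff_support_of_nonneg
    (fun _ => Real.rpow_nonneg (le_max_right _ _) _)
    (integrable_excess _ hW.measurable (fun x y => (hWB x y).1) ε hN)]
  refine hpos.trans_le (measure_mono fun q hq => ?_)
  exact (Real.rpow_pos_of_pos (lt_max_of_lt_left (sub_pos.2 hq)) _).ne'

/-- The excess norms of a bounded continuous interaction converge as the number of points
tends to infinity. -/
lemma exists_tendsto_excessNorm (μ : Measure Euc) [IsProbabilityMeasure μ]
    {Λ : Set Euc} (hΛ : Bornology.IsBounded Λ) (hs : ∀ᵐ x ∂μ, x ∈ Λ)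
    {W : Euc → Euc → ℝ} (hW : Continuous (Function.uncurry W)) {B : ℝ}
    (hWB : ∀ x y, 0 ≤ W x y ∧ W x y ≤ B) (ε : ℝ) :
    ∃ l, Tendsto (excessNorm μ W ε) atTop (nhds l) := by
  have hW0 : ∀ x y, 0 ≤ W x y := fun x y => (hWB x y).1
  refine exists_tendsto_of_superadditive (fun N _ => excessNorm_nonneg μ W ε N)
    (fun N hN => excessNorm_le_abs μ hW.measurable hW0 ε hN) (B := B) fun δ hδ => ?_
  obtain ⟨K, hK⟩ := excessNorm_superadditive_of_continuous μ hΛ hs hW hWB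
    (show 0 < δ / 4 by positivity)
  refine ⟨typeLoss K, tendsto_typeLoss K, ?_⟩
  filter_upwards [eventually_ge_atTop 2,
    (tendsto_typeLoss K).eventually (gt_mem_nhds one_lt_two)] with N hN h2
  filter_upwards [eventually_ge_atTop 1] with M hM
  have h3 := hK ε N M (by omega) hM
  have h4 := excessNorm_add_le μ hW.measurable hW0 (ε - 2 * (δ / 4))
    (show 0 ≤ 2 * (δ / 4) by positivity) hN
  rw [sub_add_cancel] at h4
  have h5 := typeLoss_pos K N
  nlinarith [mul_le_mul_of_nonneg_left h4 h5.le]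

/-- The limit of the excess norms is positive above the ground energy. -/
lemma limit_excessNorm_pos {Λ : Set Euc} (hopen : IsOpen Λ) (hΛ : Bornology.IsBounded Λ)
    (h0 : volume Λ ≠ 0) (h1 : volume Λ ≠ ∞) {W : Euc → Euc → ℝ}
    (hW : Continuous (Function.uncurry W)) {B : ℝ} (hWB : ∀ x y, 0 ≤ W x y ∧ W x y ≤ B) {ε l : ℝ}
    (hε : groundEnergy W Λ < ε) (hl : Tendsto (excessNorm (normLeb Λ) W ε) atTop (nhds l)) :
    0 < l := by
  have hprob := isProbabilityMeasure_normLeb h0 h1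
  have hs : ∀ᵐ x ∂(normLeb Λ), x ∈ Λ :=
    Measure.ae_smul_measure (ae_restrict_mem hopen.measurableSet) _
  obtain ⟨K, hK⟩ := excessNorm_superadditive_of_continuous (normLeb Λ) hΛ hs hW hWB
    (show 0 < (ε - groundEnergy W Λ) / 4 by linarith)
  obtain ⟨N, hN, hpos⟩ := exists_excessIntegral_pos hopen h0 h1 hW hWB
    (show groundEnergy W Λ < ε - 2 * ((ε - groundEnergy W Λ) / 4) by linarith)
  have hpos' := mul_pos (typeLoss_pos K N) (Real.rpow_pos_of_pos hpos (kinExp N)⁻¹)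
  have ht : Tendsto (fun M : ℕ => excessNorm (normLeb Λ) W ε M + B * N / M) atTop (nhds l) := by
    simpa using hl.add (tendsto_const_div_atTop_nhds_zero_nat (B * N))
  refine hpos'.trans_le (ge_of_tendsto ht ?_)
  filter_upwards [eventually_ge_atTop 1] with M hM
  have := hK ε N M hN hM
  unfold excessNorm at this ⊢
  linarith

/-- The interaction may be replaced by a bounded continuous one on the whole space. -/
lemma exists_continuous_extension {Λ : Set Euc} (hΛ : Bornology.IsBounded Λ) (hne : Λ.Nonempty)
    {U : Euc → Euc → ℝ} (hU0 : ∀ x ∈ closure Λ, ∀ y ∈ closure Λ, 0 ≤ U x y)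
    (hU : ContinuousOn (fun p : Euc × Euc => U p.1 p.2) (closure Λ ×ˢ closure Λ)) :
    ∃ (W : Euc → Euc → ℝ) (B : ℝ), Continuous (Function.uncurry W) ∧
      (∀ x y, 0 ≤ W x y ∧ W x y ≤ B) ∧ ∀ x ∈ closure Λ, ∀ y ∈ closure Λ, W x y = U x y := by
  have hK : IsCompact (closure Λ ×ˢ closure Λ) := hΛ.isCompact_closure.prod hΛ.isCompact_closure
  obtain ⟨B, hB⟩ := hK.bddAbove_image hU
  have hUB : ∀ p ∈ closure Λ ×ˢ closure Λ, U p.1 p.2 ∈ Icc 0 B := fun p hp =>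
    ⟨hU0 _ hp.1 _ hp.2, hB (mem_image_of_mem _ hp)⟩
  obtain ⟨x₀, hx₀⟩ := hne
  have hx₀' : (x₀, x₀) ∈ closure Λ ×ˢ closure Λ := ⟨subset_closure hx₀, subset_closure hx₀⟩
  obtain ⟨g, hg, hgU⟩ := ContinuousMap.exists_restrict_eq_forall_mem_of_closed
    (⟨_, hU.domRestrict⟩ : C(↥(closure Λ ×ˢ closure Λ), ℝ)) (t := Icc 0 B) (fun p => hUB p p.2)
    ⟨_, hUB _ hx₀'⟩ hK.isClosed
  refine ⟨fun x y => g (x, y), B, g.continuous, fun x y => hg (x, y), fun x hx y hy => ?_⟩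
  exact DFunLike.congr_fun hgU ⟨(x, y), hx, hy⟩

lemma groundEnergy_congr {Λ : Set Euc} {U W : Euc → Euc → ℝ}
    (h : ∀ x ∈ closure Λ, ∀ y ∈ closure Λ, W x y = U x y) :
    groundEnergy U Λ = groundEnergy W Λ := by
  unfold groundEnergy
  congr 1
  ext e
  refine exists_congr fun ρ => and_congr_right fun hρ => ?_
  have hs : ∀ᵐ x ∂ρ, x ∈ closure Λ := mem_ae_iff.2 hρ.2
  have : pairing U ρ ρ = pairing W ρ ρ := integral_congr_ae <| hs.mono fun x hx =>
    integral_congr_ae <| hs.mono fun y hy => by simp only [h x hx y hy]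
  rw [this]

lemma groundEnergy_nonneg {Λ : Set Euc} {W : Euc → Euc → ℝ} (hW : ∀ x y, 0 ≤ W x y) :
    0 ≤ groundEnergy W Λ := by
  refine Real.sInf_nonneg ?_
  rintro _ ⟨ρ, -, rfl⟩
  exact integral_nonneg fun x => integral_nonneg fun y => div_nonneg (hW x y) zero_le_two

/-- The configurational integral in terms of the excess norm. -/
lemma integral_piNormLeb_eq {Λ : Set Euc} (hopen : IsOpen Λ) (h0 : volume Λ ≠ 0)
    (h1 : volume Λ ≠ ∞) {U W : Euc → Euc → ℝ}
    (hsymm : ∀ x ∈ closure Λ, ∀ y ∈ closure Λ, U x y = U y x)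
    (hUW : ∀ x ∈ closure Λ, ∀ y ∈ closure Λ, W x y = U x y)
    {ε : ℝ} (hε : 0 < ε) {N : ℕ} (hN : 1 ≤ N) :
    ∫ q : Fin N → Euc, (max (1 - ε⁻¹ * empPair U N q) 0) ^ ((3 * (N : ℝ)) / 2 - 1)
      ∂(piNormLeb Λ N) = (excessNorm (normLeb Λ) W ε N / ε) ^ kinExp N := by
  have hprob := isProbabilityMeasure_normLeb h0 h1
  have hs : ∀ᵐ x ∂(normLeb Λ), x ∈ Λ :=
    Measure.ae_smul_measure (ae_restrict_mem hopen.measurableSet) _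
  have hq : ∀ᵐ q : Fin N → Euc ∂(Measure.pi fun _ => normLeb Λ), ∀ i, q i ∈ Λ :=
    eventually_all.2 fun i =>
      (Measure.tendsto_eval_ae_ae (μ := fun _ : Fin N => normLeb Λ) (i := i)).eventually hs
  have hI := excessIntegral_nonneg (normLeb Λ) W ε N
  rw [Real.div_rpow (excessNorm_nonneg _ _ _ _) hε.le, excessNorm,
    Real.rpow_inv_rpow hI (kinExp_pos hN).ne', div_eq_inv_mul (excessIntegral _ W ε N), excessIntegral,
    ← integral_const_mul, ← pi_normLeb h0 h1]
  refine integral_congr_ae (hq.mono fun q hq => ?_)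
  have hc : ∀ i, q i ∈ closure Λ := fun i => subset_closure (hq i)
  simp only
  rw [empPair_eq_meanPair (fun i j => hsymm _ (hc i) _ (hc j)) fun i j => hUW _ (hc i) _ (hc j),
    ← Real.inv_rpow hε.le, ← Real.mul_rpow (by positivity) (le_max_right _ _),
    mul_max_of_nonneg _ _ (by positivity), mul_zero, mul_sub, inv_mul_cancel₀ hε.ne']
  rfl

lemma tendsto_kinExp_div : Tendsto (fun N : ℕ => kinExp N / N) atTop (nhds (3 / 2)) := by
  have h : Tendsto (fun N : ℕ => (3 / 2 : ℝ) - 1 / N) atTop (nhds (3 / 2)) := by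
    simpa using tendsto_const_nhds.sub (tendsto_const_div_atTop_nhds_zero_nat (1 : ℝ))
  refine h.congr' ?_
  filter_upwards [eventually_ge_atTop 1] with N hN
  have : (0 : ℝ) < N := by exact_mod_cast hN
  unfold kinExp
  field_simp

theorem statement8
    (Λ : Set Euc) (hΛne : Λ.Nonempty) (hΛopen : IsOpen Λ)
    (hΛbdd : Bornology.IsBounded Λ) (hΛconn : IsConnected Λ)
    (U : Euc → Euc → ℝ)
    (hUnonneg : ∀ x ∈ closure Λ, ∀ y ∈ closure Λ, 0 ≤ U x y)
    (hUsymm : ∀ x ∈ closure Λ, ∀ y ∈ closure Λ, U x y = U y x)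
    (hUcont : ContinuousOn (fun p : Euc × Euc => U p.1 p.2) (closure Λ ×ˢ closure Λ)) :
    ∃ γ : ℝ → ℝ,
      ContinuousOn γ (Ioi (groundEnergy U Λ)) ∧
      MonotoneOn γ (Ioi (groundEnergy U Λ)) ∧
      ∀ ε : ℝ, groundEnergy U Λ < ε →
        (∃ N₀ : ℕ, ∀ N : ℕ, N₀ ≤ N →
          0 < ∫ q : Fin N → Euc,
              (max (1 - ε⁻¹ * empPair U N q) 0) ^ ((3 * (N : ℝ)) / 2 - 1)
                ∂(piNormLeb Λ N)) ∧
        Tendsto (fun N : ℕ =>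
            (Real.log (∫ q : Fin N → Euc,
                (max (1 - ε⁻¹ * empPair U N q) 0) ^ ((3 * (N : ℝ)) / 2 - 1)
                  ∂(piNormLeb Λ N))) / (N : ℝ))
          atTop (nhds (γ ε)) := by
  obtain ⟨W, B, hW, hWB, hWU⟩ := exists_continuous_extension hΛbdd hΛne hUnonneg hUcont
  have hW0 : ∀ x y, 0 ≤ W x y := fun x y => (hWB x y).1
  have h0 : volume Λ ≠ 0 := (hΛopen.measure_pos volume hΛne).ne'
  have h1 : volume Λ ≠ ∞ := hΛbdd.measure_lt_top.ne
  have hprob := isProbabilityMeasure_normLeb h0 h1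
  have hs : ∀ᵐ x ∂(normLeb Λ), x ∈ Λ :=
    Measure.ae_smul_measure (ae_restrict_mem hΛopen.measurableSet) _
  rw [groundEnergy_congr hWU]
  choose L hL using exists_tendsto_excessNorm (normLeb Λ) hΛbdd hs hW hWB
  have hεpos : ∀ {ε}, groundEnergy W Λ < ε → 0 < ε := fun h => (groundEnergy_nonneg hW0).trans_lt h
  have hLpos : ∀ {ε}, groundEnergy W Λ < ε → 0 < L ε := fun h =>
    limit_excessNorm_pos hΛopen hΛbdd h0 h1 hW hWB h (hL _)
  have hLmono : Monotone L := fun a b hab =>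
    le_of_tendsto_of_tendsto (hL a) (hL b) <| (eventually_ge_atTop 1).mono fun N hN =>
      excessNorm_mono _ hW.measurable hW0 hab hN
  have hLlip : LipschitzWith 1 L := by
    refine LipschitzWith.of_le_add fun a b => ?_
    have h := le_of_tendsto_of_tendsto (hL (b + |a - b|)) ((hL b).add_const |a - b|) <|
      (eventually_ge_atTop 2).mono fun N hN =>
        excessNorm_add_le _ hW.measurable hW0 b (abs_nonneg (a - b)) hN
    exact (hLmono (by linarith [le_abs_self (a - b)])).trans h
  refine ⟨fun ε => 3 / 2 * Real.log (L ε / ε), ?_, ?_, fun ε hε => ?_⟩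
  · refine continuousOn_const.mul (ContinuousOn.log ?_ fun ε hε => ?_)
    · exact hLlip.continuous.continuousOn.div continuousOn_id fun ε hε => (hεpos hε).ne'
    · exact (div_pos (hLpos hε) (hεpos hε)).ne'
  · intro a ha b hb hab
    refine mul_le_mul_of_nonneg_left (Real.log_le_log (div_pos (hLpos ha) (hεpos ha)) ?_)
      (by norm_num)
    exact le_of_tendsto_of_tendsto ((hL a).div_const a) ((hL b).div_const b) <|
      (eventually_ge_atTop 1).mono fun N hN =>
        excessNorm_div_mono _ hW.measurable hW0 (hεpos ha) hab hN
  · have hev : ∀ᶠ N : ℕ in atTop, 1 ≤ N ∧ 0 < excessNorm (normLeb Λ) W ε N / ε :=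
      (eventually_ge_atTop 1).and <| ((hL ε).eventually (lt_mem_nhds (hLpos hε))).mono
        fun N h => div_pos h (hεpos hε)
    refine ⟨?_, ?_⟩
    · obtain ⟨N₀, hN₀⟩ := eventually_atTop.1 hev
      refine ⟨N₀, fun N hN => ?_⟩
      obtain ⟨hN1, hpos⟩ := hN₀ N hN
      rw [integral_piNormLeb_eq hΛopen h0 h1 hUsymm hWU (hεpos hε) hN1]
      exact Real.rpow_pos_of_pos hpos _
    · have ht := tendsto_kinExp_div.mul
        (((hL ε).div_const ε).log (div_pos (hLpos hε) (hεpos hε)).ne')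
      refine ht.congr' (hev.mono fun N hN => ?_)
      beta_reduce
      rw [integral_piNormLeb_eq hΛopen h0 h1 hUsymm hWU (hεpos hε) hN.1, Real.log_rpow hN.2]
      ring
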